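/- arXiv:math/0108057 — 2 statements merged into one kernel-verified Lean document; each statement's English description precedes it below -/
import Mathlib

section
/- Let n > 1 be a natural number and let φ : M_n(ℂ) → M_n(ℂ) be a bijective transformation satisfying φ((1/2)(AB+BA)) = (1/2)(φ(A)φ(B)+φ(B)φ(A)) for all A, B ∈ M_n(ℂ). Then either (i) there exist a ring automorphism h of ℂ and an invertible matrix T ∈ M_n(ℂ) such that φ(A) = T h(A) T⁻¹ for all A ∈ M_n(ℂ), or (ii) there exist a ring automorphism h of ℂ and an invertible matrix T ∈ M_n(ℂ) such that φ(A) = T h(A)ᵗ T⁻¹ for all A ∈ M_n(ℂ); here h(A) denotes the matrix obtained from A by applying h to every entry of A and ᵗ denotes the transpose. -/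
open Matrix

set_option linter.unusedSimpArgs false

section jm
variable {R : Type*} [Ring R]

theorem jm_lem (hP : ∀ a b : R, (∀ x, a * x * b = 0) → a = 0 ∨ b = 0)
    (h2 : ∀ a : R, a + a = 0 → a = 0) (a b : R) (h : ∀ x, a * x * b + b * x * a = 0) :
    a = 0 ∨ b = 0 := by
  apply hP
  intro x
  have key : ∀ y, (a * x * b) * y * (a * x * b) = 0 := by
    intro y
    apply h2
    have e1 : b * x * a = - (a * x * b) := eq_neg_of_add_eq_zero_right (h x)
    have e2 := h (x * a * y)
    have e3 := h y
    have : (a * x * b) * y * (a * x * b) + (a * x * b) * y * (a * x * b)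
      = (a * x * b + b * x * a) * y * a * x * b - (a * (x * a * y) * b + b * (x * a * y) * a) * x * b
        + a * x * (a * y * b + b * y * a) * x * b := by noncomm_ring
    rw [this, h x, e2, e3]; simp
  rcases hP _ _ key with h | h <;> exact h

theorem jm_herstein (hP : ∀ a b : R, (∀ x, a * x * b = 0) → a = 0 ∨ b = 0)
    (h2 : ∀ a : R, a + a = 0 → a = 0) (φ : R → R) (hs : Function.Surjective φ)
    (ha : ∀ x y, φ (x + y) = φ x + φ y)
    (hm : ∀ x y, φ (x * y + y * x) = φ x * φ y + φ y * φ x) :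
    (∀ x y, φ (x * y) = φ x * φ y) ∨ (∀ x y, φ (x * y) = φ y * φ x) := by
  have hsub : ∀ x y, φ (x - y) = φ x - φ y := by
    intro x y
    have := ha (x - y) y
    rw [sub_add_cancel] at this
    rw [this]; abel
  have hsq : ∀ x, φ (x * x) = φ x * φ x := by
    intro x
    have := hm x x
    rw [ha] at this
    rw [← sub_eq_zero]
    apply h2
    have e : φ (x * x) - φ x * φ x + (φ (x * x) - φ x * φ x)
      = (φ (x*x) + φ (x * x)) - (φ x * φ x + φ x * φ x) := by abel
    rw [e, this, sub_self]
  have htri : ∀ a b, φ (a * b * a) = φ a * φ b * φ a := by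
    intro a b
    have e1 := hm a (a * b + b * a)
    have e2 := hm (a * a) b
    have e3 : a * (a * b + b * a) + (a * b + b * a) * a
      = (a * a * b + b * (a * a)) + (a * b * a + a * b * a) := by noncomm_ring
    rw [e3, ha, e2, hm, hsq, ha] at e1
    rw [← sub_eq_zero]
    apply h2
    have e4 : φ (a * b * a) - φ a * φ b * φ a + (φ (a * b * a) - φ a * φ b * φ a)
      = (φ a * φ a * φ b + φ b * (φ a * φ a) + (φ (a * b * a) + φ (a * b * a)))
        - (φ a * (φ a * φ b + φ b * φ a) + (φ a * φ b + φ b * φ a) * φ a) := by noncomm_ring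
    rw [e4, e1, sub_self]
  have htri2 : ∀ a b c, φ (a * b * c + c * b * a) = φ a * φ b * φ c + φ c * φ b * φ a := by
    intro a b c
    have e1 := htri (a + c) b
    have e3 : (a + c) * b * (a + c) = a * b * a + c * b * c + (a * b * c + c * b * a) := by
      noncomm_ring
    rw [e3, ha, ha, htri, htri, ha a c] at e1
    have e4 := eq_sub_of_add_eq' e1
    rw [e4]; noncomm_ring
  have hor : ∀ a b, φ (a * b) = φ a * φ b ∨ φ (a * b) = φ b * φ a := by
    intro a b
    have := jm_lem hP h2 (φ (a * b) - φ a * φ b) (φ (a * b) - φ b * φ a) ?_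
    · rcases this with h | h
      · exact Or.inl (sub_eq_zero.1 h)
      · exact Or.inr (sub_eq_zero.1 h)
    intro z
    obtain ⟨x, rfl⟩ := hs z
    have e1 := htri2 (a * b) x (b * a)
    have e2 : φ (b * a) = φ a * φ b + φ b * φ a - φ (a * b) := by
      rw [← hm, ha]; abel
    have e3 : a * b * x * (b * a) + b * a * x * (a * b)
      = a * (b * x * b) * a + b * (a * x * a) * b := by noncomm_ring
    rw [e3, ha, htri, htri, htri, htri, e2] at e1
    rw [← sub_eq_zero] at e1
    rw [← e1]; noncomm_ring
  have hor2 : ∀ a, (∀ b, φ (a * b) = φ a * φ b) ∨ (∀ b, φ (a * b) = φ b * φ a) := by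
    intro a
    by_contra! hc
    obtain ⟨⟨b, hb⟩, ⟨c, hc⟩⟩ := hc
    have hb' := (hor a b).resolve_left hb
    have hc' := (hor a c).resolve_right hc
    rcases hor a (b + c) with h | h
    · rw [mul_add, ha, ha, mul_add, hc'] at h
      exact hb (add_right_cancel h)
    · rw [mul_add, ha, ha, add_mul, hb'] at h
      exact hc (add_left_cancel h)
  by_contra! hc
  obtain ⟨⟨a, b, hb⟩, ⟨c, d, hd⟩⟩ := hc
  have ha' := (hor2 a).resolve_left (fun h => hb (h b))
  have hc' := (hor2 c).resolve_right (fun h => hd (h d))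
  rcases hor2 (a + c) with h | h
  · have := h b
    rw [add_mul, ha, ha, add_mul, hc'] at this
    exact hb (add_right_cancel this)
  · have := h d
    rw [add_mul, ha, ha, mul_add, ha'] at this
    exact hd (add_left_cancel this)

end jm

section jadd
variable {R : Type*} [Ring R] [Algebra ℂ R]

theorem ja_aux (φ : R → R) (hb : Function.Bijective φ)
    (hP : ∀ a b : R, (∀ x, a * x * b = 0) → a = 0 ∨ b = 0)
    (hJ : ∀ A B : R, φ (((1:ℂ)/2) • (A * B + B * A)) = ((1:ℂ)/2) • (φ A * φ B + φ B * φ A))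
    (e f : R) (hef : e + f = 1) (ee : e * e = e) (ff : f * f = f) (ef : e * f = 0)
    (fe : f * e = 0) (he0 : e ≠ 0) (hf0 : f ≠ 0) :
    (∀ x, φ x = φ (e * x * e) + φ (f * x * f) + φ (e * x * f) + φ (f * x * e)) ∧
    (∀ x y, φ (e * x * f + e * y * f) = φ (e * x * f) + φ (e * y * f)) ∧
    (∀ x y, φ (e * x * e + e * y * e) = φ (e * x * e) + φ (e * y * e)) := by
  have ee' : ∀ x, e * (e * x) = e * x := fun x => by rw [← mul_assoc, ee]
  have ff' : ∀ x, f * (f * x) = f * x := fun x => by rw [← mul_assoc, ff]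
  have ef' : ∀ x, e * (f * x) = 0 := fun x => by rw [← mul_assoc, ef, zero_mul]
  have fe' : ∀ x, f * (e * x) = 0 := fun x => by rw [← mul_assoc, fe, zero_mul]
  have h0 : φ 0 = 0 := by
    obtain ⟨z, hz⟩ := hb.2 0
    have := hJ 0 z
    simpa [hz] using this
  have dec : ∀ x : R, x = e * x * e + f * x * f + (e * x * f + f * x * e) := by
    intro x
    calc x = (e + f) * x * (e + f) := by rw [hef]; simp
      _ = _ := by noncomm_ring
  have rm : ∀ C A B X : R, φ C = φ A + φ B →
      φ (((1:ℂ)/2) • (C * X + X * C)) = φ (((1:ℂ)/2) • (A * X + X * A))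
        + φ (((1:ℂ)/2) • (B * X + X * B)) := by
    intro C A B X h
    rw [hJ, hJ, hJ, h, ← smul_add]
    congr 1; noncomm_ring
  have id1 : ∀ C : R, ((1:ℂ)/2) • ((((1:ℂ)/2) • ((((1:ℂ)/2) • (C * (e - f) + (e - f) * C)) * (e - f) + (e - f) * (((1:ℂ)/2) • (C * (e - f) + (e - f) * C)))) * e + e * (((1:ℂ)/2) • ((((1:ℂ)/2) • (C * (e - f) + (e - f) * C)) * (e - f) + (e - f) * (((1:ℂ)/2) • (C * (e - f) + (e - f) * C))))) = e * C * e := by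
    intro C
    conv_lhs => rw [dec C]
    simp only [mul_add, add_mul, mul_sub, sub_mul, mul_assoc, smul_mul_assoc, mul_smul_comm, ee, ff, ef, fe, ee', ff', ef', fe', mul_zero, zero_mul, smul_zero]
    module
  have id2 : ∀ C : R, ((1:ℂ)/2) • ((((1:ℂ)/2) • ((((1:ℂ)/2) • (C * (e - f) + (e - f) * C)) * (e - f) + (e - f) * (((1:ℂ)/2) • (C * (e - f) + (e - f) * C)))) * f + f * (((1:ℂ)/2) • ((((1:ℂ)/2) • (C * (e - f) + (e - f) * C)) * (e - f) + (e - f) * (((1:ℂ)/2) • (C * (e - f) + (e - f) * C))))) = f * C * f := by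
    intro C
    conv_lhs => rw [dec C]
    simp only [mul_add, add_mul, mul_sub, sub_mul, mul_assoc, smul_mul_assoc, mul_smul_comm, ee, ff, ef, fe, ee', ff', ef', fe', mul_zero, zero_mul, smul_zero]
    module
  have id3 : ∀ C : R, ((1:ℂ)/2) • ((((1:ℂ)/2) • (C * e + e * C)) * ((4:ℂ) • f) + ((4:ℂ) • f) * (((1:ℂ)/2) • (C * e + e * C))) = e * C * f + f * C * e := by
    intro C
    conv_lhs => rw [dec C]
    simp only [mul_add, add_mul, mul_sub, sub_mul, mul_assoc, smul_mul_assoc, mul_smul_comm, ee, ff, ef, fe, ee', ff', ef', fe', mul_zero, zero_mul, smul_zero]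
    module
  have p1 : ∀ C A B : R, φ C = φ A + φ B → φ (e * C * e) = φ (e * A * e) + φ (e * B * e) := by
    intro C A B h
    rw [← id1 C, ← id1 A, ← id1 B]
    exact rm _ _ _ _ (rm _ _ _ _ (rm _ _ _ _ h))
  have p2 : ∀ C A B : R, φ C = φ A + φ B → φ (f * C * f) = φ (f * A * f) + φ (f * B * f) := by
    intro C A B h
    rw [← id2 C, ← id2 A, ← id2 B]
    exact rm _ _ _ _ (rm _ _ _ _ (rm _ _ _ _ h))
  have p3 : ∀ C A B : R, φ C = φ A + φ B →
      φ (e * C * f + f * C * e) = φ (e * A * f + f * A * e) + φ (e * B * f + f * B * e) := by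
    intro C A B h
    rw [← id3 C, ← id3 A, ← id3 B]
    exact rm _ _ _ _ (rm _ _ _ _ h)
  have s1 : ∀ x y, φ (e * x * e + f * y * f) = φ (e * x * e) + φ (f * y * f) := by
    intro x y
    obtain ⟨C, h⟩ := hb.2 (φ (e * x * e) + φ (f * y * f))
    rw [← h]
    have h1 := p1 _ _ _ h
    have h2 := p2 _ _ _ h
    have h3 := p3 _ _ _ h
    simp only [mul_assoc, ee, ff, ef, fe, ee', ff', ef', fe', mul_zero, zero_mul, h0, add_zero, zero_add] at h1 h2 h3
    have h1 := hb.1 h1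
    have h2 := hb.1 h2
    have h3 := hb.1 (h3.trans h0.symm)
    rw [dec C]
    simp only [mul_assoc, h1, h2, h3, add_zero]
  have s2 : ∀ x y z, φ (e * x * e + f * x * f + (e * y * f + f * z * e)) =
      φ (e * x * e + f * x * f) + φ (e * y * f + f * z * e) := by
    intro x y z
    obtain ⟨C, h⟩ := hb.2 (φ (e * x * e + f * x * f) + φ (e * y * f + f * z * e))
    rw [← h]
    have h1 := p1 _ _ _ h
    have h2 := p2 _ _ _ h
    have h3 := p3 _ _ _ h
    simp only [mul_add, add_mul, mul_assoc, ee, ff, ef, fe, ee', ff', ef', fe', mul_zero, zero_mul, h0, add_zero, zero_add] at h1 h2 h3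
    have h1 := hb.1 h1
    have h2 := hb.1 h2
    have h3 := hb.1 h3
    rw [dec C]
    simp only [mul_assoc, h1, h2, h3, add_zero]
  have half0 : ∀ x y : R, ((1:ℂ)/2) • x = ((1:ℂ)/2) • y → x = y := by
    intro x y h
    have := congrArg (fun t => (2:ℂ) • t) h
    simpa [smul_smul] using this
  have s3 : ∀ x y, φ (e * x * f + f * y * e) = φ (e * x * f) + φ (f * y * e) := by
    intro x y
    obtain ⟨C, h⟩ := hb.2 (φ (e * x * f) + φ (f * y * e))
    rw [← h]
    have h1 := p1 _ _ _ h
    have h2 := p2 _ _ _ h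
    simp only [mul_assoc, ee, ff, ef, fe, ee', ff', ef', fe', mul_zero, zero_mul, h0, add_zero, zero_add] at h1 h2
    have h1 := hb.1 (h1.trans h0.symm)
    have h2 := hb.1 (h2.trans h0.symm)
    have h3 : f * (C - y) * e = 0 := by
      refine (hP e _ ?_).resolve_left he0
      intro t
      have := rm _ _ _ (e * t * f) h
      simp only [mul_add, add_mul, mul_assoc, ee, ff, ef, fe, ee', ff', ef', fe', mul_zero, zero_mul, smul_zero, h0, add_zero, zero_add] at this
      have := congrArg (fun t => e * t * e) (half0 _ _ (hb.1 this))
      simp only [mul_add, add_mul, mul_assoc, ee, ff, ef, fe, ee', ff', ef', fe', mul_zero, zero_mul, smul_zero, h0, add_zero, zero_add] at this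
      simp only [mul_sub, sub_mul, mul_assoc]
      rw [← sub_eq_zero] at this
      exact this
    have h4 : e * (C - x) * f = 0 := by
      refine (hP f _ ?_).resolve_left hf0
      intro t
      have := rm _ _ _ (f * t * e) h
      simp only [mul_add, add_mul, mul_assoc, ee, ff, ef, fe, ee', ff', ef', fe', mul_zero, zero_mul, smul_zero, h0, add_zero, zero_add] at this
      have := congrArg (fun t => f * t * f) (half0 _ _ (hb.1 this))
      simp only [mul_add, add_mul, mul_assoc, ee, ff, ef, fe, ee', ff', ef', fe', mul_zero, zero_mul, smul_zero, h0, add_zero, zero_add] at this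
      simp only [mul_sub, sub_mul, mul_assoc]
      rw [← sub_eq_zero] at this
      exact this
    rw [mul_sub, sub_mul, sub_eq_zero] at h3 h4
    rw [dec C, h3, h4]
    simp only [mul_assoc, h1, h2, zero_add]
  have s4 : ∀ x, φ x = φ (e * x * e) + φ (f * x * f) + φ (e * x * f) + φ (f * x * e) := by
    intro x
    conv_lhs => rw [dec x]
    rw [s2, s1, s3]; abel
  have s5 : ∀ x y, φ (e * x * f + e * y * f) = φ (e * x * f) + φ (e * y * f) := by
    intro x y
    have a1 : φ (e + (2:ℂ) • (e * x * f)) = φ e + φ ((2:ℂ) • (e * x * f)) := by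
      have := s2 e ((2:ℂ) • x) 0
      simpa [mul_assoc, ee, ef, fe] using this
    have a2 : φ (f + (2:ℂ) • (e * y * f)) = φ f + φ ((2:ℂ) • (e * y * f)) := by
      have := s2 f ((2:ℂ) • y) 0
      simpa [mul_assoc, ff, ef, fe] using this
    have k1 := hJ (e + (2:ℂ) • (e * x * f)) (f + (2:ℂ) • (e * y * f))
    have k2 := hJ e f
    have k3 := hJ e ((2:ℂ) • (e * y * f))
    have k4 := hJ ((2:ℂ) • (e * x * f)) f
    have k5 := hJ ((2:ℂ) • (e * x * f)) ((2:ℂ) • (e * y * f))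
    have i1 : ((1:ℂ)/2) • ((e + (2:ℂ) • (e * x * f)) * (f + (2:ℂ) • (e * y * f)) + (f + (2:ℂ) • (e * y * f)) * (e + (2:ℂ) • (e * x * f))) = e * x * f + e * y * f := by
      simp only [mul_add, add_mul, mul_assoc, smul_mul_assoc, mul_smul_comm, ee, ff, ef, fe, ee', ff', ef', fe', mul_zero, zero_mul, smul_zero]
      module
    have i3 : ((1:ℂ)/2) • (e * ((2:ℂ) • (e * y * f)) + ((2:ℂ) • (e * y * f)) * e) = e * y * f := by
      simp only [mul_assoc, smul_mul_assoc, mul_smul_comm, ee, ff, ef, fe, ee', ff', ef', fe', mul_zero, zero_mul, smul_zero]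
      module
    have i4 : ((1:ℂ)/2) • (((2:ℂ) • (e * x * f)) * f + f * ((2:ℂ) • (e * x * f))) = e * x * f := by
      simp only [mul_assoc, smul_mul_assoc, mul_smul_comm, ee, ff, ef, fe, ee', ff', ef', fe', mul_zero, zero_mul, smul_zero]
      module
    have i5 : ((1:ℂ)/2) • (((2:ℂ) • (e * x * f)) * ((2:ℂ) • (e * y * f)) + ((2:ℂ) • (e * y * f)) * ((2:ℂ) • (e * x * f))) = 0 := by
      simp only [mul_assoc, smul_mul_assoc, mul_smul_comm, ee, ff, ef, fe, ee', ff', ef', fe', mul_zero, zero_mul, smul_zero, add_zero]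
    have i2 : ((1:ℂ)/2) • (e * f + f * e) = 0 := by simp [ef, fe]
    rw [i1, a1, a2] at k1
    rw [i2, h0] at k2
    rw [i3] at k3
    rw [i4] at k4
    rw [i5, h0] at k5
    have : ((1:ℂ)/2) • ((φ e + φ ((2:ℂ) • (e * x * f))) * (φ f + φ ((2:ℂ) • (e * y * f))) + (φ f + φ ((2:ℂ) • (e * y * f))) * (φ e + φ ((2:ℂ) • (e * x * f))))
      = ((1:ℂ)/2) • (φ e * φ f + φ f * φ e) + ((1:ℂ)/2) • (φ e * φ ((2:ℂ) • (e * y * f)) + φ ((2:ℂ) • (e * y * f)) * φ e)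
        + ((1:ℂ)/2) • (φ ((2:ℂ) • (e * x * f)) * φ f + φ f * φ ((2:ℂ) • (e * x * f)))
        + ((1:ℂ)/2) • (φ ((2:ℂ) • (e * x * f)) * φ ((2:ℂ) • (e * y * f)) + φ ((2:ℂ) • (e * y * f)) * φ ((2:ℂ) • (e * x * f))) := by
      simp only [← smul_add]
      congr 1
      noncomm_ring
    rw [k1, this, ← k2, ← k3, ← k4, ← k5]
    abel
  refine ⟨s4, s5, ?_⟩
  intro x y
  obtain ⟨C, h⟩ := hb.2 (φ (e * x * e) + φ (e * y * e))
  rw [← h]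
  have h1 := p2 _ _ _ h
  have h2 := p3 _ _ _ h
  simp only [mul_assoc, ee, ff, ef, fe, ee', ff', ef', fe', mul_zero, zero_mul, h0, add_zero, zero_add] at h1 h2
  have h1 := hb.1 (h1.trans h0.symm)
  have h2 := hb.1 (h2.trans h0.symm)
  have h3 : e * (C - (x + y)) * e = 0 := by
    refine (hP _ f ?_).resolve_right hf0
    intro t
    have := rm _ _ _ (e * t * f) (p1 _ _ _ h)
    have s := s5 (((1:ℂ)/2) • (x * e * t)) (((1:ℂ)/2) • (y * e * t))
    simp only [mul_add, add_mul, mul_assoc, ee, ff, ef, fe, ee', ff', ef', fe', mul_zero, zero_mul, smul_zero, h0, add_zero, zero_add, mul_smul_comm, smul_mul_assoc] at this s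
    rw [← s, ← smul_add] at this
    have := (half0 _ _ (hb.1 this))
    simp only [mul_sub, sub_mul, mul_assoc, mul_add, add_mul]
    rw [← sub_eq_zero] at this
    exact this
  rw [mul_sub, sub_mul, sub_eq_zero] at h3
  rw [dec C, h3]
  simp only [mul_assoc, h1, h2, add_zero, mul_add, add_mul]

theorem ja_add (φ : R → R) (hb : Function.Bijective φ)
    (hP : ∀ a b : R, (∀ x, a * x * b = 0) → a = 0 ∨ b = 0)
    (hJ : ∀ A B : R, φ (((1:ℂ)/2) • (A * B + B * A)) = ((1:ℂ)/2) • (φ A * φ B + φ B * φ A))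
    (e : R) (ee : e * e = e) (he0 : e ≠ 0) (he1 : e ≠ 1) (x y : R) :
    φ (x + y) = φ x + φ y := by
  have ff : (1 - e) * (1 - e) = 1 - e := by
    simp [mul_sub, sub_mul, ee]
  have ef : e * (1 - e) = 0 := by simp [mul_sub, ee]
  have fe : (1 - e) * e = 0 := by simp [sub_mul, ee]
  have hf0 : 1 - e ≠ 0 := fun h => he1 (sub_eq_zero.1 h).symm
  obtain ⟨s, a1, a2⟩ := ja_aux φ hb hP hJ e (1 - e) (by abel) ee ff ef fe he0 hf0
  obtain ⟨-, b1, b2⟩ := ja_aux φ hb hP hJ (1 - e) e (by abel) ff ee fe ef hf0 he0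
  rw [s (x + y), s x, s y]
  have k : ∀ u v : R, u * (x + y) * v = u * x * v + u * y * v := fun u v => by
    rw [mul_add, add_mul]
  rw [k, k, k, k, a1, a2, b1, b2]
  abel

theorem ja_full (φ : R → R) (hb : Function.Bijective φ)
    (hP : ∀ a b : R, (∀ x, a * x * b = 0) → a = 0 ∨ b = 0)
    (hJ : ∀ A B : R, φ (((1:ℂ)/2) • (A * B + B * A)) = ((1:ℂ)/2) • (φ A * φ B + φ B * φ A))
    (e : R) (ee : e * e = e) (he0 : e ≠ 0) (he1 : e ≠ 1) :
    (∀ x y, φ (x + y) = φ x + φ y) ∧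
    ((∀ x y, φ (x * y) = φ x * φ y) ∨ (∀ x y, φ (x * y) = φ y * φ x)) := by
  have ha := ja_add φ hb hP hJ e ee he0 he1
  refine ⟨ha, jm_herstein hP ?_ φ hb.2 ha ?_⟩
  · intro a h
    have : a = ((1:ℂ)/2) • (a + a) := by module
    rw [this, h, smul_zero]
  · intro x y
    have h := hJ x y
    have h1 : x * y + y * x = ((1:ℂ)/2) • (x * y + y * x) + ((1:ℂ)/2) • (x * y + y * x) := by
      module
    rw [h1, ha, h]
    module

end jadd

theorem ja_prime (n : ℕ) (a b : Matrix (Fin n) (Fin n) ℂ) (h : ∀ x, a * x * b = 0) :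
    a = 0 ∨ b = 0 := by
  by_contra! hc
  obtain ⟨h1, h2⟩ := hc
  have h1' : ∃ i j, a i j ≠ 0 := by
    by_contra! hh; exact h1 (by ext i j; simp [hh])
  have h2' : ∃ i j, b i j ≠ 0 := by
    by_contra! hh; exact h2 (by ext i j; simp [hh])
  obtain ⟨i, j, hij⟩ := h1'
  obtain ⟨k, l, hkl⟩ := h2'
  have := congrFun (congrFun (h (Matrix.single j k 1)) i) l
  rw [Matrix.mul_assoc, Matrix.mul_apply, Finset.sum_eq_single j] at this
  · simp [hij, hkl] at this
  · intro t _ ht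
    simp [Matrix.single_mul_apply_of_ne, ht]
  · simp

theorem ja_scalar (n : ℕ) (σ : Matrix (Fin n) (Fin n) ℂ ≃+* Matrix (Fin n) (Fin n) ℂ) (c : ℂ) :
    ∃ d, σ (Matrix.scalar (Fin n) c) = Matrix.scalar (Fin n) d := by
  have : σ (Matrix.scalar (Fin n) c) ∈ Set.range (Matrix.scalar (Fin n)) := by
    rw [Matrix.mem_range_scalar_iff_commute_single]
    intro i j _
    obtain ⟨z, hz⟩ := σ.surjective (Matrix.single i j 1)
    rw [← hz]
    exact ((Matrix.scalar_commute c (fun r => Commute.all _ _) z).map σ).symm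
  obtain ⟨d, hd⟩ := this
  exact ⟨d, hd.symm⟩

theorem ja_auto (n : ℕ) (hn : 1 < n)
    (σ : Matrix (Fin n) (Fin n) ℂ ≃+* Matrix (Fin n) (Fin n) ℂ) :
    ∃ (h : ℂ ≃+* ℂ) (T : Matrix (Fin n) (Fin n) ℂ), IsUnit T ∧
      ∀ A : Matrix (Fin n) (Fin n) ℂ, σ A = T * A.map ⇑h * T⁻¹ := by
  have : Nonempty (Fin n) := ⟨⟨0, by omega⟩⟩
  have inj : Function.Injective (Matrix.scalar (Fin n) : ℂ → _) :=
    fun a b hab => Matrix.scalar_inj.1 hab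
  choose h hh using ja_scalar n σ
  choose g hg using ja_scalar n σ.symm
  let H : ℂ ≃+* ℂ :=
    { toFun := h
      invFun := g
      left_inv := fun c => inj (by rw [← hg, ← hh]; simp only [RingEquiv.symm_apply_apply])
      right_inv := fun c => inj (by rw [← hh, ← hg]; simp only [RingEquiv.apply_symm_apply])
      map_mul' := fun a b => inj (by rw [← hh, map_mul, map_mul, hh, hh, map_mul])
      map_add' := fun a b => inj (by rw [← hh, map_add, map_add, hh, hh, map_add]) }
  have hH : ∀ c, σ (Matrix.scalar (Fin n) c) = Matrix.scalar (Fin n) (H c) := hh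
  let ψ : Matrix (Fin n) (Fin n) ℂ ≃ₐ[ℂ] Matrix (Fin n) (Fin n) ℂ :=
    AlgEquiv.ofRingEquiv (f := (RingEquiv.mapMatrix H.symm).trans σ) (by
      intro c
      have : (algebraMap ℂ (Matrix (Fin n) (Fin n) ℂ)) c = Matrix.scalar (Fin n) c := rfl
      rw [this, RingEquiv.trans_apply]
      have h2 : (RingEquiv.mapMatrix H.symm) (Matrix.scalar (Fin n) c)
          = Matrix.scalar (Fin n) (H.symm c) := by
        ext i j
        by_cases hij : i = j
        · subst hij; simp
        · simp [hij]
      rw [h2, hH, RingEquiv.apply_symm_apply])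
  have hψ : ∀ A, σ A = ψ (A.map H) := by
    intro A
    change σ A = σ ((A.map H).map H.symm)
    congr 1
    ext i j
    simp
  obtain ⟨T, hT⟩ := AlgEquiv.eq_linearEquivConjAlgEquiv
    ((Matrix.toLinAlgEquiv'.symm.trans ψ).trans
      (Matrix.toLinAlgEquiv' : Matrix (Fin n) (Fin n) ℂ ≃ₐ[ℂ] _))
  have k1 : LinearMap.toMatrix' (T : (Fin n → ℂ) →ₗ[ℂ] (Fin n → ℂ)) *
      LinearMap.toMatrix' (T.symm : (Fin n → ℂ) →ₗ[ℂ] (Fin n → ℂ)) = 1 := by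
    rw [← LinearMap.toMatrix'_comp]; simp
  refine ⟨H, LinearMap.toMatrix' (T : (Fin n → ℂ) →ₗ[ℂ] (Fin n → ℂ)), ?_, ?_⟩
  · exact IsUnit.of_mul_eq_one _ k1
  · intro A
    rw [Matrix.inv_eq_right_inv k1, hψ]
    have := congrArg (fun F => LinearMap.toMatrix' (F (Matrix.toLin' (A.map H)))) hT
    have e1 : LinearMap.toMatrix' (Matrix.toLin' (ψ (A.map H))) = LinearMap.toMatrix'
       ((T : (Fin n → ℂ) →ₗ[ℂ] (Fin n → ℂ)) ∘ₗ (Matrix.toLin' (A.map H)) ∘ₗ (T.symm : (Fin n → ℂ) →ₗ[ℂ] (Fin n → ℂ))) := by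
      convert this using 2
      · simp only [AlgEquiv.trans_apply]
        change _ = Matrix.toLin' (ψ (LinearMap.toMatrix' (Matrix.toLin' (A.map H))))
        rw [LinearMap.toMatrix'_toLin']
      · rfl
    rw [LinearMap.toMatrix'_toLin', LinearMap.toMatrix'_comp, LinearMap.toMatrix'_comp,
      LinearMap.toMatrix'_toLin', ← Matrix.mul_assoc] at e1
    exact e1

/-- **Theorem 1 (finite-dimensional case).** Bijective solutions of the Jordan
equation `φ((1/2)(AB+BA)) = (1/2)(φ(A)φ(B)+φ(B)φ(A))` on the algebra `M_n(ℂ)`,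
`n > 1`, are of the form `A ↦ T h(A) T⁻¹` or `A ↦ T h(A)ᵗ T⁻¹` for a ring
automorphism `h` of `ℂ` and an invertible matrix `T`. -/
theorem jordan_maps_matrix_algebra (n : ℕ) (hn : 1 < n)
    (φ : Matrix (Fin n) (Fin n) ℂ → Matrix (Fin n) (Fin n) ℂ)
    (hbij : Function.Bijective φ)
    (hJ : ∀ A B : Matrix (Fin n) (Fin n) ℂ,
      φ (((1:ℂ)/2) • (A * B + B * A)) = ((1:ℂ)/2) • (φ A * φ B + φ B * φ A)) :
    (∃ (h : ℂ ≃+* ℂ) (T : Matrix (Fin n) (Fin n) ℂ), IsUnit T ∧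
      ∀ A : Matrix (Fin n) (Fin n) ℂ, φ A = T * A.map ⇑h * T⁻¹) ∨
    (∃ (h : ℂ ≃+* ℂ) (T : Matrix (Fin n) (Fin n) ℂ), IsUnit T ∧
      ∀ A : Matrix (Fin n) (Fin n) ℂ, φ A = T * (A.map ⇑h)ᵀ * T⁻¹) := by
  obtain ⟨ha, hm⟩ := ja_full φ hbij (ja_prime n) hJ
    (Matrix.single ⟨0, by omega⟩ ⟨0, by omega⟩ 1) (by simp) (by
      intro h
      have := congrFun (congrFun h ⟨0, by omega⟩) ⟨0, by omega⟩
      simp at this) (by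
      intro h
      have := congrFun (congrFun h ⟨1, hn⟩) ⟨1, hn⟩
      simp [Matrix.single_apply] at this)
  rcases hm with hm | hm
  · left
    exact ja_auto n hn
      { Equiv.ofBijective φ hbij with
        map_mul' := hm
        map_add' := ha }
  · right
    obtain ⟨h, T, hT, hA⟩ := ja_auto n hn
      { (Matrix.transposeAddEquiv (Fin n) (Fin n) ℂ).toEquiv.trans (Equiv.ofBijective φ hbij) with
        map_mul' := fun x y => by
          change φ (x * y)ᵀ = φ xᵀ * φ yᵀ
          rw [Matrix.transpose_mul, hm]
        map_add' := fun x y => by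
          change φ (x + y)ᵀ = φ xᵀ + φ yᵀ
          rw [Matrix.transpose_add, ha] }
    refine ⟨h, T, hT, fun A => ?_⟩
    have := hA Aᵀ
    change φ Aᵀᵀ = _ at this
    rw [Matrix.transpose_transpose] at this
    rw [this, Matrix.transpose_map]
end

section
/- Let n > 1 be a natural number. Suppose ψ : M_n(ℂ) → M_n(ℂ) is a bijective transformation such that ψ(A*) = ψ(A)* and ψ(AB+BA) = ψ(A)ψ(B)+ψ(B)ψ(A) for all A, B ∈ M_n(ℂ). Then ψ also satisfies ψ((1/2)(AB+BA)) = (1/2)(ψ(A)ψ(B)+ψ(B)ψ(A)) for all A, B ∈ M_n(ℂ). -/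
lemma scalar_of_comm {n : ℕ} (c : Matrix (Fin n) (Fin n) ℂ)
    (h : ∀ B, B * c = c * B) : ∃ s : ℂ, c = s • 1 := by
  have := Matrix.mem_range_scalar_of_commute_single (M := c) (fun i j _ => h _)
  obtain ⟨s, hs⟩ := this
  refine ⟨s, ?_⟩
  rw [← hs, Matrix.scalar_apply, Matrix.smul_one_eq_diagonal]

lemma eig_half {n : ℕ} (F Y : Matrix (Fin n) (Fin n) ℂ) (hY : Y ≠ 0) (s : ℂ)
    (hF : F * F + F * F = F) (hE : F * Y + Y * F = (2 * s) • Y)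
    (h0 : s ≠ 0) (h1 : s ≠ 1/2) : s = 1/4 := by
  have hF2 : F * F = ((1:ℂ)/2) • F := by
    have : (2:ℂ) • (F * F) = F := by rw [two_smul]; exact hF
    calc F * F = ((1:ℂ)/2) • ((2:ℂ) • (F * F)) := by rw [smul_smul]; norm_num
      _ = _ := by rw [this]
  have a1 : ((1:ℂ)/2) • (F * Y) + F * Y * F = (2 * s) • (F * Y) := by
    have := congrArg (fun Z => F * Z) hE
    simpa [mul_add, ← mul_assoc, hF2] using this
  have a2 : F * Y * F + ((1:ℂ)/2) • (Y * F) = (2 * s) • (Y * F) := by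
    have := congrArg (fun Z => Z * F) hE
    simpa [add_mul, mul_assoc, hF2] using this
  have a3 : ((1:ℂ)/2) • (F * Y * F) + ((1:ℂ)/2) • (F * Y * F) = (2 * s) • (F * Y * F) := by
    have := congrArg (fun Z => Z * F) a1
    simp only [add_mul, smul_mul_assoc] at this
    rw [mul_assoc (F * Y) F F, hF2, mul_smul_comm] at this
    exact this
  have b3 : F * Y * F = 0 := by
    have : (1 - 2 * s) • (F * Y * F) = 0 := by
      rw [sub_smul, ← a3]; module
    rcases smul_eq_zero.1 this with h | h
    · exact absurd (by linear_combination (-1/2) * h) h1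
    · exact h
  by_contra h4
  have h5 : (1:ℂ)/2 - 2 * s ≠ 0 := fun h => h4 (by linear_combination (-1/2) * h)
  have b1 : F * Y = 0 := by
    have : ((1:ℂ)/2 - 2 * s) • (F * Y) = 0 := by
      rw [sub_smul, ← a1, b3]; simp
    exact (smul_eq_zero.1 this).resolve_left h5
  have b2 : Y * F = 0 := by
    have : ((1:ℂ)/2 - 2 * s) • (Y * F) = 0 := by
      rw [sub_smul, ← a2, b3]; simp
    exact (smul_eq_zero.1 this).resolve_left h5
  rw [b1, b2, add_zero] at hE
  rcases smul_eq_zero.1 hE.symm with h | h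
  · exact h0 (by linear_combination (1/2) * h)
  · exact hY h

/-- **Lemma 7.** A bijective `*`-preserving map `ψ` on `M_n(ℂ)`, `n > 1`, satisfying
`ψ(AB+BA) = ψ(A)ψ(B)+ψ(B)ψ(A)` also satisfies the halved Jordan equation
`ψ((1/2)(AB+BA)) = (1/2)(ψ(A)ψ(B)+ψ(B)ψ(A))`. -/
theorem matrix_jordan_no_half_implies_half (n : ℕ) (hn : 1 < n)
    (ψ : Matrix (Fin n) (Fin n) ℂ → Matrix (Fin n) (Fin n) ℂ)
    (hbij : Function.Bijective ψ)
    (hstar : ∀ A : Matrix (Fin n) (Fin n) ℂ, ψ (star A) = star (ψ A))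
    (hJ : ∀ A B : Matrix (Fin n) (Fin n) ℂ,
      ψ (A * B + B * A) = ψ A * ψ B + ψ B * ψ A) :
    ∀ A B : Matrix (Fin n) (Fin n) ℂ,
      ψ (((1:ℂ)/2) • (A * B + B * A)) = ((1:ℂ)/2) • (ψ A * ψ B + ψ B * ψ A) := by
  obtain ⟨hinj, hsurj⟩ := hbij
  have hz : ψ 0 = 0 := by
    obtain ⟨A, hA⟩ := hsurj 0
    have := hJ 0 A
    simpa [hA] using this
  have hone : ψ (((1:ℂ)/2) • 1) = ((1:ℂ)/2) • 1 := by
    obtain ⟨A, hA⟩ := hsurj 1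
    have := hJ A (((1:ℂ)/2) • 1)
    have e : A * (((1:ℂ)/2) • 1) + (((1:ℂ)/2) • 1) * A = A := by
      simp only [mul_smul_comm, smul_mul_assoc, mul_one, one_mul]; module
    rw [e, hA, one_mul, mul_one] at this
    nth_rewrite 2 [this]
    module
  set q : Matrix (Fin n) (Fin n) ℂ := ((1:ℂ)/4) • 1 with hq
  have hqmul : ∀ A, A * q + q * A = ((1:ℂ)/2) • A := by
    intro A
    simp only [hq, mul_smul_comm, smul_mul_assoc, mul_one, one_mul]; module
  set c := ψ q with hc
  have hcm : ∀ A, ψ (((1:ℂ)/2) • A) = ψ A * c + c * ψ A := by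
    intro A; rw [← hqmul, hJ]
  have hnuc : ∀ A B, (A * c - c * A) * B = B * (A * c - c * A) := by
    intro A' B'
    obtain ⟨A, rfl⟩ := hsurj A'
    obtain ⟨B, rfl⟩ := hsurj B'
    have h1 := hcm (A * B + B * A)
    have h2 := hJ A (((1:ℂ)/2) • B)
    have e : A * (((1:ℂ)/2) • B) + (((1:ℂ)/2) • B) * A = ((1:ℂ)/2) • (A * B + B * A) := by
      simp only [mul_smul_comm, smul_mul_assoc, smul_add]
    rw [e, h1, hJ, hcm] at h2
    rw [← sub_eq_zero] at h2 ⊢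
    rw [← neg_eq_zero, ← h2]
    noncomm_ring
  have hn0 : (n:ℂ) ≠ 0 := by exact_mod_cast (by omega : n ≠ 0)
  obtain ⟨s, hs⟩ : ∃ s : ℂ, c = s • 1 := by
    apply scalar_of_comm
    intro A
    obtain ⟨z, hz'⟩ := scalar_of_comm (A * c - c * A) (fun B => (hnuc A B).symm)
    have ht := congrArg Matrix.trace hz'
    rw [Matrix.trace_sub, Matrix.trace_mul_comm, sub_self, Matrix.trace_smul, Matrix.trace_one] at ht
    have : z = 0 := by simpa [hn0, (by omega : n ≠ 0)] using ht.symm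
    rw [this, zero_smul] at hz'
    exact sub_eq_zero.1 hz'
  have hhalf : ∀ A, ψ (((1:ℂ)/2) • A) = (2 * s) • ψ A := by
    intro A
    rw [hcm, hs]
    simp only [mul_smul_comm, smul_mul_assoc, mul_one, one_mul]; module
  let i : Fin n := ⟨0, by omega⟩
  let j : Fin n := ⟨1, hn⟩
  have hij : i ≠ j := by simp [i, j]
  have hs0 : s ≠ 0 := by
    rintro rfl
    have : q = 0 := hinj (by rw [hz, ← hc, hs, zero_smul])
    have := congrFun (congrFun this i) i
    simp [hq] at this
  have hs1 : s ≠ 1/2 := by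
    rintro rfl
    have : q = ((1:ℂ)/2) • 1 := hinj (by rw [hone, ← hc, hs])
    have := congrFun (congrFun this i) i
    simp [hq] at this
  let P : Matrix (Fin n) (Fin n) ℂ := Matrix.single i i (1/2)
  let X : Matrix (Fin n) (Fin n) ℂ := Matrix.single i j 1
  have hP : P * P + P * P = P := by
    simp only [P, Matrix.single_mul_single_same, ← Matrix.single_add]; norm_num
  have hPX : P * X + X * P = ((1:ℂ)/2) • X := by
    simp only [P, X, Matrix.single_mul_single_same, Matrix.smul_single]
    rw [Matrix.single_mul_single_of_ne _ _ _ _ hij.symm]; simp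
  have hX : X ≠ 0 := by
    intro h
    have := congrFun (congrFun h i) j
    simp [X] at this
  have key : s = 1/4 := by
    apply eig_half (ψ P) (ψ X) _ s _ _ hs0 hs1
    · intro h; exact hX (hinj (h.trans hz.symm))
    · rw [← hJ, hP]
    · rw [← hJ, hPX, hhalf]
  intro A B
  rw [hhalf, hJ, key]; norm_num
end
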